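/- Let G be the parallel composition of multigraphs G1 and G2 at distinct vertices a and b, and let r_a, r_b ∈ ℤ with r_a + r_b = 0. Then mincost(G, [a ↦ r_a, b ↦ r_b]) = ⨅_{r ∈ ℤ} ( mincost(G1, [a ↦ r, b ↦ −r]) + mincost(G2, [a ↦ r_a − r, b ↦ r_b + r]) ), where the infimum and addition are in ℕ∞. -/

import Mathlib

open scoped BigOperators

/-- An undirected multigraph on vertex type `V` with edge type `E`:
each edge has a reference orientation `src e → tgt e`, a cost `c e` and a capacity `u e`. -/
structure Multigraph (V E : Type) where
  src : E → V
  tgt : E → V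
  c : E → ℕ
  u : E → ℕ

variable {V E : Type}

/-- The residue of a flow assignment `f : E → ℤ` at a vertex `v`:
inflow (w.r.t. the reference orientation) minus outflow. -/
def Multigraph.residue [Fintype E] [DecidableEq V] (G : Multigraph V E)
    (f : E → ℤ) (v : V) : ℤ :=
  (∑ e : E, if G.tgt e = v then f e else 0) - (∑ e : E, if G.src e = v then f e else 0)

/-- `f` is an `r`-circulation supported on `F`: it vanishes outside `F`,
respects capacities, and has residue `r v` at every vertex `v`. -/
def Multigraph.IsCirculation [Fintype E] [DecidableEq V] (G : Multigraph V E)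
    (r : V → ℤ) (F : Finset E) (f : E → ℤ) : Prop :=
  (∀ e, e ∉ F → f e = 0) ∧ (∀ e, |f e| ≤ (G.u e : ℤ)) ∧ (∀ v, G.residue f v = r v)

/-- The minimum cost (in `ℕ∞`) of a subset `F` of the allowed edge set `E'`
admitting an `r`-circulation supported on `F`.  Taking `E' = Finset.univ`
gives `mincost(G, r)`; taking `E' = E₁` for a sub-multigraph `(V₁, E₁)` all of
whose edges have both endpoints in `V₁` gives `mincost(G₁, r)` whenever `r`
vanishes outside `V₁`. -/
noncomputable def Multigraph.mincostOn [Fintype E] [DecidableEq V] (G : Multigraph V E)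
    (E' : Finset E) (r : V → ℤ) : ℕ∞ :=
  ⨅ (F : Finset E) (_ : F ⊆ E' ∧ ∃ f : E → ℤ, G.IsCirculation r F f),
    ((∑ e ∈ F, G.c e : ℕ) : ℕ∞)

namespace Multigraph

variable [Fintype E] [DecidableEq V]

theorem residue_add (G : Multigraph V E) (f g : E → ℤ) (v : V) :
    G.residue (f + g) v = G.residue f v + G.residue g v := by
  have key (h : E → V) : (∑ e, if h e = v then (f + g) e else 0) =
      (∑ e, if h e = v then f e else 0) + ∑ e, if h e = v then g e else 0 := by
    rw [← Finset.sum_add_distrib]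
    refine Finset.sum_congr rfl fun e _ => ?_
    split_ifs <;> simp
  simp only [residue, key]
  ring

/-- The residues of a flow assignment sum to zero over all vertices. -/
theorem sum_residue [Fintype V] (G : Multigraph V E) (f : E → ℤ) :
    ∑ v, G.residue f v = 0 := by
  have key (h : E → V) : (∑ v, ∑ e, if h e = v then f e else 0) = ∑ e, f e := by
    rw [Finset.sum_comm]
    simp
  simp only [residue, Finset.sum_sub_distrib, key, sub_self]

/-- A flow assignment has zero residue at a vertex outside a set containing the endpoints of all
edges of its support. -/
theorem residue_eq_zero (G : Multigraph V E) {W : Finset V} {F : Finset E}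
    (hF : ∀ e ∈ F, G.src e ∈ W ∧ G.tgt e ∈ W) {f : E → ℤ} (hf : ∀ e, e ∉ F → f e = 0)
    {v : V} (hv : v ∉ W) : G.residue f v = 0 := by
  have key (h : E → V) (hW : ∀ e ∈ F, h e ∈ W) : (∑ e, if h e = v then f e else 0) = 0 := by
    refine Finset.sum_eq_zero fun e _ => ?_
    split_ifs with hev
    · exact hf e fun he => hv (hev ▸ hW e he)
    · rfl
  rw [residue, key _ fun e he => (hF e he).1, key _ fun e he => (hF e he).2, sub_self]

theorem residue_off_pair [Fintype V] (G : Multigraph V E) {a b : V} (hab : a ≠ b) {f : E → ℤ}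
    (h : ∀ v, v ≠ a → v ≠ b → G.residue f v = 0) : G.residue f b = -G.residue f a := by
  have hs : ∑ v, G.residue f v = G.residue f a + G.residue f b :=
    Fintype.sum_eq_add a b hab fun v hv => h v hv.1 hv.2
  rw [sum_residue] at hs
  linarith

theorem mincostOn_le (G : Multigraph V E) {E' F : Finset E} {r : V → ℤ} {f : E → ℤ}
    (hF : F ⊆ E') (hf : G.IsCirculation r F f) :
    G.mincostOn E' r ≤ ((∑ e ∈ F, G.c e : ℕ) : ℕ∞) :=
  iInf₂_le F ⟨hF, f, hf⟩

/-- A finite minimum cost is attained. -/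
theorem exists_mincostOn_eq (G : Multigraph V E) {E' : Finset E} {r : V → ℤ}
    (h : G.mincostOn E' r ≠ ⊤) :
    ∃ F ⊆ E', ∃ f, G.IsCirculation r F f ∧ G.mincostOn E' r = ((∑ e ∈ F, G.c e : ℕ) : ℕ∞) := by
  rw [mincostOn, iInf_subtype'] at h ⊢
  cases isEmpty_or_nonempty {F : Finset E // F ⊆ E' ∧ ∃ f, G.IsCirculation r F f} with
  | inl hempty => exact absurd (iInf_of_empty _) h
  | inr hne =>
    obtain ⟨⟨F, hF, f, hf⟩, hFeq⟩ := ciInf_mem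
      fun F : {F : Finset E // F ⊆ E' ∧ ∃ f, G.IsCirculation r F f} =>
        ((∑ e ∈ F.1, G.c e : ℕ) : ℕ∞)
    exact ⟨F, hF, f, hf, hFeq.symm⟩

/-- Circulations on disjoint edge sets add up. -/
theorem IsCirculation.add [DecidableEq E] {G : Multigraph V E} {r s : V → ℤ} {F F' : Finset E}
    {f g : E → ℤ} (hf : G.IsCirculation r F f) (hg : G.IsCirculation s F' g)
    (hd : Disjoint F F') : G.IsCirculation (r + s) (F ∪ F') (f + g) := by
  obtain ⟨hf0, hfu, hfr⟩ := hf
  obtain ⟨hg0, hgu, hgr⟩ := hg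
  refine ⟨fun e he => ?_, fun e => ?_, fun v => ?_⟩
  · rw [Finset.mem_union, not_or] at he
    simp [hf0 e he.1, hg0 e he.2]
  · by_cases he : e ∈ F
    · simpa [hg0 e (Finset.disjoint_left.1 hd he)] using hfu e
    · simpa [hf0 e he] using hgu e
  · simp [residue_add, hfr, hgr]

theorem mincostOn_union_le [DecidableEq E] (G : Multigraph V E) {E₁ E₂ : Finset E}
    (hd : Disjoint E₁ E₂) (r s : V → ℤ) :
    G.mincostOn (E₁ ∪ E₂) (r + s) ≤ G.mincostOn E₁ r + G.mincostOn E₂ s := by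
  by_cases h₁ : G.mincostOn E₁ r = ⊤
  · simp [h₁]
  by_cases h₂ : G.mincostOn E₂ s = ⊤
  · simp [h₂]
  obtain ⟨F, hF, f, hf, hr⟩ := G.exists_mincostOn_eq h₁
  obtain ⟨F', hF', g, hg, hs⟩ := G.exists_mincostOn_eq h₂
  have hFF' : Disjoint F F' := Finset.disjoint_of_subset_left hF
    (Finset.disjoint_of_subset_right hF' hd)
  rw [hr, hs, ← Nat.cast_add, ← Finset.sum_union hFF']
  exact G.mincostOn_le (Finset.union_subset_union hF hF') (hf.add hg hFF')

/-- Restricting a circulation to a set of edges. -/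
theorem IsCirculation.restrict [DecidableEq E] {G : Multigraph V E} {r : V → ℤ} {F : Finset E}
    {f : E → ℤ} (hf : G.IsCirculation r F f) (E' : Finset E) :
    G.IsCirculation (G.residue fun e => if e ∈ E' then f e else 0) (F ∩ E')
      fun e => if e ∈ E' then f e else 0 := by
  refine ⟨fun e he => ?_, fun e => ?_, fun _ => rfl⟩
  · rw [Finset.mem_inter] at he
    by_cases he' : e ∈ E'
    · simp [hf.1 e fun h => he ⟨h, he'⟩]
    · simp [he']
  · by_cases he' : e ∈ E'
    · simpa [he'] using hf.2.1 e
    · simp [he']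

end Multigraph

/-- Case 1.2: parallel composition, 2-tuple of residues. -/
theorem parallel_two_tuple {V E : Type}
    [Fintype V] [Fintype E] [DecidableEq V] [DecidableEq E]
    (G : Multigraph V E) (V1 V2 : Finset V) (E1 E2 : Finset E)
    (hE : E1 ∪ E2 = Finset.univ) (hEdisj : Disjoint E1 E2)
    (hV : V1 ∪ V2 = Finset.univ)
    (hG1 : ∀ e ∈ E1, G.src e ∈ V1 ∧ G.tgt e ∈ V1)
    (hG2 : ∀ e ∈ E2, G.src e ∈ V2 ∧ G.tgt e ∈ V2)
    (a b : V) (hab : a ≠ b) (hVab : V1 ∩ V2 = {a, b})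
    (ra rb : ℤ) (hsum : ra + rb = 0) :
    G.mincostOn Finset.univ (fun v => if v = a then ra else if v = b then rb else 0) =
      ⨅ r : ℤ,
        G.mincostOn E1 (fun v => if v = a then r else if v = b then -r else 0) +
        G.mincostOn E2 (fun v => if v = a then ra - r else if v = b then rb + r else 0) := by
  refine le_antisymm (le_iInf fun r => ?_) (le_iInf₂ fun F hF => ?_)
  · have hr : (fun v => if v = a then ra else if v = b then rb else 0) =
        (fun v => if v = a then r else if v = b then -r else 0) +
          fun v => if v = a then ra - r else if v = b then rb + r else 0 := by
      funext v
      simp only [Pi.add_apply]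
      split_ifs <;> ring
    rw [← hE, hr]
    exact G.mincostOn_union_le hEdisj _ _
  · obtain ⟨-, f, hf⟩ := hF
    have h₁ := hf.restrict E1
    have h₂ := hf.restrict E2
    set f₁ : E → ℤ := fun e => if e ∈ E1 then f e else 0 with hf₁
    set f₂ : E → ℤ := fun e => if e ∈ E2 then f e else 0 with hf₂
    have hadd : f₁ + f₂ = f := by
      ext e
      have he : e ∈ E1 ∨ e ∈ E2 := Finset.mem_union.1 (hE ▸ Finset.mem_univ e)
      have hd : e ∈ E1 → e ∉ E2 := fun h => Finset.disjoint_left.1 hEdisj h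
      by_cases h : e ∈ E1
      · simp [hf₁, hf₂, h, hd h]
      · simp [hf₁, hf₂, h, he.resolve_left h]
    have hres (v : V) : G.residue f₁ v + G.residue f₂ v =
        if v = a then ra else if v = b then rb else 0 := by
      rw [← G.residue_add, hadd, hf.2.2 v]
    have hoff (v : V) (hva : v ≠ a) (hvb : v ≠ b) : G.residue f₁ v = 0 := by
      by_cases hv₁ : v ∈ V1
      · have hv₂ : v ∉ V2 := fun hv₂ => by
          have : v ∈ V1 ∩ V2 := Finset.mem_inter.2 ⟨hv₁, hv₂⟩
          simp [hVab, hva, hvb] at this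
        have := hres v
        rw [G.residue_eq_zero (f := f₂) hG2 (fun e he => if_neg he) hv₂] at this
        simpa [hva, hvb] using this
      · exact G.residue_eq_zero hG1 (fun e he => if_neg he) hv₁
    have hb := G.residue_off_pair hab hoff
    have hr₁ : G.residue f₁ =
        fun v => if v = a then G.residue f₁ a else if v = b then -G.residue f₁ a else 0 := by
      ext v
      split_ifs with hva hvb
      · rw [hva]
      · rw [hvb, hb]
      · exact hoff v hva hvb
    have hr₂ : G.residue f₂ = fun v =>
        if v = a then ra - G.residue f₁ a else if v = b then rb + G.residue f₁ a else 0 := by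
      ext v
      have hv := hres v
      split_ifs at hv ⊢ with hva hvb
      · subst hva; linarith
      · subst hvb; linarith
      · rw [hoff v hva hvb] at hv
        linarith
    have hcost : ∑ e ∈ F, G.c e = ∑ e ∈ F ∩ E1, G.c e + ∑ e ∈ F ∩ E2, G.c e := by
      rw [← Finset.sum_union (hEdisj.mono Finset.inter_subset_right Finset.inter_subset_right),
        ← Finset.inter_union_distrib_left, hE, Finset.inter_univ]
    rw [hcost, Nat.cast_add]
    refine iInf_le_of_le (G.residue f₁ a) ?_
    rw [← hr₁, ← hr₂]
    exact add_le_add (G.mincostOn_le Finset.inter_subset_right h₁)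
      (G.mincostOn_le Finset.inter_subset_right h₂)
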